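/- For n ≥ 3 and 1 ≤ p ≤ n−1, the determinant of the n×n matrix M(n,p,a), which is the tridiagonal matrix with unit diagonal and all off-diagonal entries 1/2 except the pair in positions (p,p+1),(p+1,p) which equal a, is (1/2^n)·[(p+1)(n−p+1) − 4a²p(n−p)]. -/

import Mathlib

/-- `M(n,p,a)`: the symmetric tridiagonal `n×n` matrix (1-based positions) with
unit diagonal and all off-diagonal pairs `1/2`, except `a` at positions
`(p,p+1),(p+1,p)`. -/
noncomputable def Mmask1 (n p : ℕ) (a : ℝ) : Matrix (Fin n) (Fin n) ℝ :=
  Matrix.of fun i j =>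
    if (i : ℕ) = j then 1
    else if (i : ℕ) + 1 = j ∨ (j : ℕ) + 1 = i then
      (if min (i : ℕ) j + 1 = p then a else 1/2)
    else 0

theorem Mmask1_rec (n p : ℕ) (a : ℝ) :
    (Mmask1 (n+2) p a).det = (Mmask1 (n+1) p a).det
      - (if n + 1 = p then a else 1/2)^2 * (Mmask1 n p a).det := by
  rw [Matrix.det_succ_row _ (Fin.last (n+1)), Fin.sum_univ_castSucc, Fin.sum_univ_castSucc]
  rw [Finset.sum_eq_zero]
  · have h1 : (Mmask1 (n+2) p a).submatrix (Fin.last (n+1)).succAbove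
        (Fin.last (n+1)).succAbove = Mmask1 (n+1) p a := by
      ext i j
      simp [Mmask1]
    have h2 : ((Mmask1 (n+2) p a).submatrix (Fin.last (n+1)).succAbove
        (Fin.last n).castSucc.succAbove).det
        = (if n + 1 = p then a else 1/2) * (Mmask1 n p a).det := by
      rw [Matrix.det_succ_column _ (Fin.last n), Fin.sum_univ_castSucc, Finset.sum_eq_zero]
      · have h3 : ((Mmask1 (n+2) p a).submatrix (Fin.last (n+1)).succAbove
          (Fin.last n).castSucc.succAbove).submatrix (Fin.last n).succAbove
            (Fin.last n).succAbove = Mmask1 n p a := by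
          ext i j
          have : (Fin.last n).castSucc.succAbove j.castSucc = j.castSucc.castSucc := by
            apply Fin.succAbove_of_castSucc_lt
            simp [Fin.lt_def]
          simp [Mmask1, this]
        rw [h3]
        have h4 : (Fin.last n).castSucc.succAbove (Fin.last n) = Fin.last (n+1) := by
          rw [Fin.succAbove_of_le_castSucc _ _ le_rfl]; simp
        simp [Mmask1, h4, ← two_mul]
      · intro i _
        have h4 : (Fin.last n).castSucc.succAbove (Fin.last n) = Fin.last (n+1) := by
          rw [Fin.succAbove_of_le_castSucc _ _ le_rfl]; simp
        have := i.2
        have e : Mmask1 (n+2) p a i.castSucc.castSucc (Fin.last (n+1)) = 0 := by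
          simp only [Mmask1, Matrix.of_apply, Fin.val_castSucc, Fin.val_last]
          rw [if_neg (by omega), if_neg (by omega)]
        simp [h4, e]
    rw [h1, h2]
    have e1 : Mmask1 (n+2) p a (Fin.last (n+1)) (Fin.last (n+1)) = 1 := by simp [Mmask1]
    have e2 : Mmask1 (n+2) p a (Fin.last (n+1)) (Fin.last n).castSucc
        = (if n + 1 = p then a else 1/2) := by
      simp [Mmask1]
    rw [e1, e2]
    have s1 : (-1:ℝ) ^ (((Fin.last (n+1) : Fin (n+2)) : ℕ) + ((Fin.last n).castSucc : Fin (n+2)))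
        = -1 := by
      apply Odd.neg_one_pow
      simp only [Fin.val_castSucc, Fin.val_last]
      exact ⟨n, by ring⟩
    have s2 : (-1:ℝ) ^ (((Fin.last (n+1) : Fin (n+2)) : ℕ) + (Fin.last (n+1) : Fin (n+2)))
        = 1 := by
      apply Even.neg_one_pow
      exact ⟨_, rfl⟩
    rw [s1, s2]
    ring
  · intro i _
    have := i.2
    have e : Mmask1 (n+2) p a (Fin.last (n+1)) i.castSucc.castSucc = 0 := by
      simp only [Mmask1, Matrix.of_apply, Fin.val_castSucc, Fin.val_last]
      rw [if_neg (by omega), if_neg (by omega)]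
    simp [e]

theorem Mmask1_low (p : ℕ) (a : ℝ) : ∀ k : ℕ, k ≤ p →
    (Mmask1 k p a).det = ((k:ℝ) + 1) / 2 ^ k
  | 0, _ => by simp
  | 1, _ => by simp [Mmask1]
  | k+2, h => by
    rw [Mmask1_rec, Mmask1_low p a (k+1) (by omega), Mmask1_low p a k (by omega),
      if_neg (by omega)]
    push_cast
    field_simp
    ring

theorem Mmask1_high (q : ℕ) (a : ℝ) : ∀ m : ℕ,
    (Mmask1 (q + 1 + m) (q+1) a).det =
      (1 / 2 ^ (q + 1 + m)) * (((q : ℝ) + 2) * ((m : ℝ) + 1) - 4 * a^2 * (q + 1) * m)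
  | 0 => by
    rw [Mmask1_low _ _ _ (by omega)]
    push_cast
    ring
  | 1 => by
    rw [show q + 1 + 1 = q + 2 from rfl, Mmask1_rec, if_pos rfl,
      Mmask1_low _ _ _ le_rfl, Mmask1_low _ _ _ (by omega)]
    push_cast
    field_simp
    ring
  | m+2 => by
    have h1 := Mmask1_high q a (m+1)
    have h0 := Mmask1_high q a m
    rw [show q + 1 + (m + 2) = (q + 1 + m) + 2 from rfl, Mmask1_rec, if_neg (by omega), h0,
      show q + 1 + m + 1 = q + 1 + (m + 1) from rfl, h1]
    push_cast
    field_simp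
    ring

/-- Determinant formula for `M(n,p,a)`. -/
theorem det_Mmask1 (n p : ℕ) (a : ℝ) (hn : 3 ≤ n) (hp : 1 ≤ p) (hpn : p ≤ n - 1) :
    (Mmask1 n p a).det =
      (1 / 2 ^ n) *
        (((p : ℝ) + 1) * ((n : ℝ) - p + 1) - 4 * a^2 * p * ((n : ℝ) - p)) := by
  obtain ⟨q, rfl⟩ : ∃ q, p = q + 1 := ⟨p - 1, by omega⟩
  obtain ⟨m, rfl⟩ : ∃ m, n = q + 1 + m := ⟨n - (q + 1), by omega⟩
  rw [Mmask1_high]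
  push_cast
  ring
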